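/- Let w and w' be ternary words such that w = ϑ₁(w) and w' = ϑ₂(w') for some ϑ₁, ϑ₂ ∈ {R,E_0,E_1,E_2}, w is a prefix of w', |w'| = |w| + 2, and the factor of w' of length |w| starting at position 1 (0-indexed) is not an image of w. Then there exist pairwise distinct letters i, j, k ∈ {0,1,2} such that w' is a prefix of one of the infinite periodic words (ij)^ω, (ijji)^ω, (ijk)^ω, (ijik)^ω, (ijjkki)^ω, (ijkj)^ω, (iijj)^ω, (iijjkk)^ω. -/

import Mathlib

/-- The ternary alphabet. -/
abbrev Letter := Fin 3

/-- Finite words over the ternary alphabet. -/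
abbrev Word := List Letter

/-- The four involutory antimorphisms of ternary words: the reversal `R`
and, for each letter `i`, the antimorphism `E i`. -/
inductive AM where
  | R : AM
  | E : Letter → AM
deriving DecidableEq

/-- The action of an antimorphism on a single letter: `R` fixes every letter,
and `E i` fixes `i` and exchanges the other two letters (in `Fin 3`,
this involution is `a ↦ -(i + a)`). -/
def AM.letter : AM → Letter → Letter
  | .R, _a => _a
  | .E i, a => -(i + a)

/-- The action of an antimorphism on a word: letterwise image followed by reversal. -/
def AM.apply (t : AM) (w : Word) : Word := (w.map t.letter).reverse

/-- A word is a pseudopalindrome if it is a `ϑ`-palindrome for some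
`ϑ ∈ {R, E_0, E_1, E_2}`. -/
def IsPseudopal (w : Word) : Prop := ∃ t : AM, t.apply w = w

/-- `v` is an image of `w` if `v = ϑ(w)` for some `ϑ ∈ {R, E_0, E_1, E_2}`. -/
def IsImage (w v : Word) : Prop := ∃ t : AM, v = t.apply w

/-- `v` is the `ϑ`-palindromic closure of `u`: the shortest `ϑ`-palindrome
having `u` as a prefix. -/
def IsPalClosure (t : AM) (u v : Word) : Prop :=
  u <+: v ∧ t.apply v = v ∧
    ∀ v' : Word, u <+: v' → t.apply v' = v' → v.length ≤ v'.length

/-- `w` is the sequence of prefixes associated with the directive bi-sequence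
`(Δ, Θ)`: `w 0 = ε` and `w (n+1) = (w n · δ_{n+1})^{ϑ_{n+1}}`. -/
def DirectivePrefixes (Δ : ℕ → Letter) (Θ : ℕ → AM) (w : ℕ → Word) : Prop :=
  w 0 = [] ∧ ∀ n : ℕ, IsPalClosure (Θ (n + 1)) (w n ++ [Δ (n + 1)]) (w (n + 1))

/-- A pseudopalindromic prefix `v` of `w_{n+1}` is missed between `w_n` and `w_{n+1}`
if `|w_n| < |v| < |w_{n+1}|`. -/
def MissedBetween (wn wn1 v : Word) : Prop :=
  v <+: wn1 ∧ IsPseudopal v ∧ wn.length < v.length ∧ v.length < wn1.length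

/-- An image of `u` occurs in `v` at (0-indexed) position `p`. -/
def OccursImageAt (u v : Word) (p : ℕ) : Prop :=
  p + u.length ≤ v.length ∧ IsImage u ((v.drop p).take u.length)

/-- Assumption A for the pair `(wn, wn1)`: some image of `wn` occurs in `wn1`
at a position `p` with `0 < p < |wn1| - |wn|`, overlapping both the prefix
occurrence of `wn` and the suffix occurrence of an image of `wn`. -/
def AssumptionA (wn wn1 : Word) : Prop :=
  ∃ p : ℕ, 0 < p ∧ p < wn1.length - wn.length ∧ p < wn.length ∧
    wn1.length - wn.length < p + wn.length ∧ OccursImageAt wn wn1 p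

/-- The prefix of length `n` of the directive bi-sequence is normalized:
every pseudopalindromic prefix of `w n` equals `w k` for some `k ≤ n`. -/
def NormalizedUpTo (w : ℕ → Word) (n : ℕ) : Prop :=
  ∀ v : Word, v <+: w n → IsPseudopal v → ∃ k : ℕ, k ≤ n ∧ v = w k

/-- `rep u l` is the `l`-fold concatenation `u^l`. -/
def rep (u : Word) (l : ℕ) : Word := (List.replicate l u).flatten

/-- `rmSuf x y` is `x · y⁻¹`: the word `x` with its suffix of length `|y|` removed. -/
def rmSuf (x y : Word) : Word := x.take (x.length - y.length)

/-- `v` is a prefix of the infinite periodic word `pat^ω`. -/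
def IsPrefixOfPow (pat v : Word) : Prop :=
  ∀ q : ℕ, ∀ hq : q < v.length, ∃ hp : q % pat.length < pat.length,
    v.get ⟨q, hq⟩ = pat.get ⟨q % pat.length, hp⟩

instance : Fintype AM where
  elems := {.R, .E 0, .E 1, .E 2}
  complete := by
    rintro (_ | i)
    · simp
    · fin_cases i <;> simp

/-- The infinite word `x` with `x 0 = a`, `x 1 = b` and `x (q + 2) = s (x q)`. -/
def twoStep (s : Letter → Letter) (a b : Letter) : ℕ → Letter
  | 0 => a
  | 1 => b
  | q + 2 => s (twoStep s a b q)

theorem twoStep_add_twelve (t₁ t₂ : AM) (a b : Letter) (q : ℕ) :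
    twoStep (fun x => t₂.letter (t₁.letter x)) a b (q + 12)
      = twoStep (fun x => t₂.letter (t₁.letter x)) a b q := by
  simp only [twoStep]
  generalize twoStep (fun x => t₂.letter (t₁.letter x)) a b q = x
  revert t₁ t₂ x; decide +kernel

theorem twoStep_mod_twelve (t₁ t₂ : AM) (a b : Letter) (q : ℕ) :
    twoStep (fun x => t₂.letter (t₁.letter x)) a b (q % 12)
      = twoStep (fun x => t₂.letter (t₁.letter x)) a b q :=
  (show Function.Periodic (twoStep (fun x => t₂.letter (t₁.letter x)) a b) 12 from
    twoStep_add_twelve t₁ t₂ a b).map_mod_nat q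

/-- The eight periodic patterns on the letters `i`, `j`, `k`. -/
def patterns (i j k : Letter) : List Word :=
  [[i, j], [i, j, j, i], [i, j, k], [i, j, i, k], [i, j, j, k, k, i], [i, j, k, j],
    [i, i, j, j], [i, i, j, j, k, k]]

theorem exists_pattern_of_twoStep_mod_twelve (t₁ t₂ : AM) (a b : Letter) (m : Fin 12)
    (h₀ : t₁.letter (twoStep (fun x => t₂.letter (t₁.letter x)) a b (m + 1)) = a)
    (h₁ : t₁.letter (twoStep (fun x => t₂.letter (t₁.letter x)) a b m) = b)
    (h : ∀ t : AM, ∃ q : Fin 12, twoStep (fun x => t₂.letter (t₁.letter x)) a b (q + 1)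
      ≠ t.letter (t₁.letter (twoStep (fun x => t₂.letter (t₁.letter x)) a b q))) :
    ∃ i j k : Letter, (i ≠ j ∧ j ≠ k ∧ i ≠ k) ∧ ∃ p ∈ patterns i j k,
      ∀ q : Fin 12, p[q.val % p.length]? =
        some (twoStep (fun x => t₂.letter (t₁.letter x)) a b q) := by
  revert t₁ t₂ a b m; decide +kernel

theorem AM.getElem_apply (t : AM) (w : Word) (q : ℕ) (hq : q < (t.apply w).length)
    (hq' : w.length - 1 - q < w.length) :
    (t.apply w)[q] = t.letter w[w.length - 1 - q] := by
  simp [AM.apply]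

theorem AM.letter_getElem_of_apply_eq {t : AM} {w : Word} (h : t.apply w = w) {p q : ℕ}
    (hpq : p + q + 1 = w.length) :
    w[p]'(by omega) = t.letter (w[q]'(by omega)) := by
  have h' : w[p]'(by omega) = (t.apply w)[p]'(by rw [h]; omega) := by simp only [h]
  rw [h', AM.getElem_apply t w p _ (by omega)]
  congr 2
  omega

theorem isPrefixOfPow_of_forall {p v : Word} {f : ℕ → Letter}
    (hv : ∀ q, ∀ hq : q < v.length, v[q] = f q)
    (hp : ∀ q, p[q % p.length]? = some (f q)) : IsPrefixOfPow p v := by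
  intro q hq
  obtain ⟨hlt, he⟩ := List.getElem?_eq_some_iff.1 (hp q)
  exact ⟨hlt, by simp [hv q hq, he]⟩

theorem dvd_twelve_of_mem_patterns {i j k : Letter} {p : Word} (hp : p ∈ patterns i j k) :
    p.length ∣ 12 := by
  simp only [patterns, List.mem_cons, List.not_mem_nil, or_false] at hp
  rcases hp with rfl | rfl | rfl | rfl | rfl | rfl | rfl | rfl <;> simp

theorem isImage_of_length_le_one {w v : Word} (hw : w.length ≤ 1) (hv : v.length = w.length) :
    IsImage w v := by
  match w, v with
  | [], [] => exact ⟨.R, rfl⟩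
  | [a], [b] =>
    have : ∀ a b : Letter, ∃ t : AM, [b] = t.apply [a] := by decide
    exact this a b
  | [], _ :: _ => simp at hv
  | [_], [] => simp at hv
  | [_], _ :: _ :: _ => simp at hv
  | _ :: _ :: _, _ => simp at hw

/-- Lemma: let `w` be a `ϑ₁`-palindrome that is a prefix of a `ϑ₂`-palindrome `w'`
with `|w'| = |w| + 2`, and suppose the factor of `w'` of length `|w|` starting at
position `1` is not an image of `w` (i.e., Assumption A fails). Then `w'` is a
prefix of one of eight periodic words. -/
theorem two_letter_extension_is_periodic (t₁ t₂ : AM) (w w' : Word)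
    (h₁ : t₁.apply w = w) (h₂ : t₂.apply w' = w')
    (hpre : w <+: w') (hlen : w'.length = w.length + 2)
    (hnoimage : ¬ IsImage w ((w'.drop 1).take w.length)) :
    ∃ i j k : Letter, i ≠ j ∧ j ≠ k ∧ i ≠ k ∧
      (IsPrefixOfPow [i, j] w' ∨
       IsPrefixOfPow [i, j, j, i] w' ∨
       IsPrefixOfPow [i, j, k] w' ∨
       IsPrefixOfPow [i, j, i, k] w' ∨
       IsPrefixOfPow [i, j, j, k, k, i] w' ∨
       IsPrefixOfPow [i, j, k, j] w' ∨
       IsPrefixOfPow [i, i, j, j] w' ∨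
       IsPrefixOfPow [i, i, j, j, k, k] w') := by
  have hw2 : 2 ≤ w.length := by
    by_contra hlt
    exact hnoimage (isImage_of_length_le_one (by omega) (by simp; omega))
  have hpal : ∀ p q (_ : p + q + 1 = w.length),
      w'[p]'(by omega) = t₁.letter (w'[q]'(by omega)) := by
    intro p q hpq
    rw [← hpre.getElem (show p < w.length by omega), ← hpre.getElem (show q < w.length by omega)]
    exact AM.letter_getElem_of_apply_eq h₁ hpq
  have hstep : ∀ q (_ : q < w.length),
      w'[q + 2]'(by omega) = t₂.letter (t₁.letter (w'[q]'(by omega))) := by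
    intro q hq
    rw [← hpal (w.length - 1 - q) q (by omega)]
    exact AM.letter_getElem_of_apply_eq h₂ (by omega)
  obtain ⟨a, b, hf⟩ : ∃ a b, ∀ q, ∀ hq : q < w'.length, w'[q] =
      twoStep (fun x => t₂.letter (t₁.letter x)) a b q := by
    refine ⟨w'[0], w'[1], fun q => ?_⟩
    induction q using Nat.twoStepInduction with
    | zero => intro _; rfl
    | one => intro _; rfl
    | more q ih _ =>
      intro hq
      rw [hstep q (by omega), ih (by omega), twoStep]
  obtain ⟨m, hm⟩ := Nat.exists_eq_add_of_le' hw2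
  have hmod := twoStep_mod_twelve t₁ t₂ a b
  have hsucc : ∀ q, twoStep (fun x => t₂.letter (t₁.letter x)) a b (q % 12 + 1)
      = twoStep (fun x => t₂.letter (t₁.letter x)) a b (q + 1) := by
    intro q
    rw [← hmod (q % 12 + 1), ← hmod (q + 1)]
    congr 1
    omega
  obtain ⟨i, j, k, ⟨hij, hjk, hik⟩, p, hp, hpq⟩ :=
    exists_pattern_of_twoStep_mod_twelve t₁ t₂ a b ⟨m % 12, Nat.mod_lt _ (by simp)⟩
      (by
        have := hpal 0 (m + 1) (by omega)
        rw [hf 0, hf (m + 1)] at this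
        rw [hsucc, ← this, twoStep])
      (by
        have := hpal 1 m (by omega)
        rw [hf 1, hf m] at this
        rw [hmod, ← this, twoStep])
      (by
        intro t
        by_contra! hall
        refine hnoimage ⟨t, List.ext_getElem (by simp [AM.apply]; omega) fun q hq hq' => ?_⟩
        have hqw : q < w.length := by simpa [AM.apply] using hq'
        have hq1 := hall ⟨q % 12, Nat.mod_lt _ (by simp)⟩
        simp only [hsucc, hmod] at hq1
        rw [AM.getElem_apply t w q hq' (by omega), hpre.getElem,
          hpal (w.length - 1 - q) q (by omega), hf, ← hq1, ← hf (q + 1) (by omega)]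
        simp)
  refine ⟨i, j, k, hij, hjk, hik, ?_⟩
  have hpow : IsPrefixOfPow p w' := isPrefixOfPow_of_forall hf fun q => by
    have := hpq ⟨q % 12, Nat.mod_lt _ (by simp)⟩
    simpa only [hmod, Nat.mod_mod_of_dvd q (dvd_twelve_of_mem_patterns hp)] using this
  simp only [patterns, List.mem_cons, List.not_mem_nil, or_false] at hp
  rcases hp with rfl | rfl | rfl | rfl | rfl | rfl | rfl | rfl <;> simp only [hpow, true_or, or_true]
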